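/- arXiv:1904.13256 — 3 statements merged into one kernel-verified Lean document; each statement's English description precedes it below -/
import Mathlib

section
/- Let A be an n×n matrix over the max-plus algebra whose diagonal entries are all finite and which satisfies Σ_{i=1}^n a_{iσ(i)} ≤ Σ_{i=1}^n a_{ii} for every permutation σ of {1,…,n}. Then the product L_A U_A agrees with A on the first row, on the first column, and on the diagonal; that is, (L_A U_A)_{1j} = a_{1j} and (L_A U_A)_{j1} = a_{j1} for all 1 ≤ j ≤ n, and (L_A U_A)_{ii} = a_{ii} for all 1 ≤ i ≤ n. -/
open Finset

noncomputable section

/-- The max-plus algebra `ℝ ∪ {−∞}`: the lattice `max` (i.e. `⊔`) is the semiring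
addition and `+` (with `⊥ = −∞` absorbing) is the semiring multiplication. -/
abbrev Rmax : Type := WithBot ℝ

/-- Max-plus matrix product: `(A ⬝ B) i j = max_k (A i k + B k j)`. -/
def mpMulMat {n : ℕ} (A B : Fin n → Fin n → Rmax) : Fin n → Fin n → Rmax :=
  fun i j => univ.sup fun k => A i k + B k j

/-- Max-plus matrix-vector product: `(A ⬝ x) i = max_k (A i k + x k)`. -/
def mpMulVec {n : ℕ} (A : Fin n → Fin n → Rmax) (x : Fin n → Rmax) : Fin n → Rmax :=
  fun i => univ.sup fun k => A i k + x k

/-- The lower triangular factor `L_A` of `A`, whose (finite) diagonal entries are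
given by the real vector `d` (so `(L_A) i j = A i j − A j j` for `j ≤ i`). -/
def Lfac {n : ℕ} (A : Fin n → Fin n → Rmax) (d : Fin n → ℝ) : Fin n → Fin n → Rmax :=
  fun i j => if j ≤ i then A i j + ((-(d j) : ℝ) : Rmax) else ⊥

/-- The upper triangular factor `U_A` of `A`. -/
def Ufac {n : ℕ} (A : Fin n → Fin n → Rmax) : Fin n → Fin n → Rmax :=
  fun i j => if i ≤ j then A i j else ⊥

theorem mp_pair {n : ℕ} (A : Fin n → Fin n → Rmax) (d : Fin n → ℝ)
    (hdiag : ∀ i, A i i = (d i : Rmax))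
    (hdet : ∀ σ : Equiv.Perm (Fin n), ∑ i, A i (σ i) ≤ ∑ i, A i i)
    (i k : Fin n) (hik : i ≠ k) : A i k + A k i ≤ ((d i + d k : ℝ) : Rmax) := by
  have h := hdet (Equiv.swap i k)
  have hk : k ∈ univ.erase i := by simp [hik.symm]
  rw [← Finset.add_sum_erase univ _ (mem_univ i), ← Finset.add_sum_erase _ _ hk,
    ← Finset.add_sum_erase univ (fun i => A i i) (mem_univ i),
    ← Finset.add_sum_erase _ (fun i => A i i) hk] at h
  have e1 : ∑ x ∈ (univ.erase i).erase k, A x (Equiv.swap i k x)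
      = ((∑ x ∈ (univ.erase i).erase k, d x : ℝ) : Rmax) := by
    rw [WithBot.coe_sum]
    refine Finset.sum_congr rfl fun x hx => ?_
    simp only [mem_erase, mem_univ, and_true] at hx
    rw [Equiv.swap_apply_of_ne_of_ne hx.2 hx.1, hdiag]
  have e2 : ∑ x ∈ (univ.erase i).erase k, A x x
      = ((∑ x ∈ (univ.erase i).erase k, d x : ℝ) : Rmax) := by
    rw [WithBot.coe_sum]
    exact Finset.sum_congr rfl fun x _ => hdiag x
  rw [e1, e2, hdiag, hdiag, Equiv.swap_apply_left, Equiv.swap_apply_right] at h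
  generalize ∑ x ∈ (univ.erase i).erase k, d x = r at h
  generalize A i k = a at *
  generalize A k i = b at *
  induction a using WithBot.recBotCoe with
  | bot => simp
  | coe a =>
    induction b using WithBot.recBotCoe with
    | bot => simp
    | coe b =>
      norm_cast at h ⊢
      linarith

theorem mp_cancel (r : ℝ) (a : Rmax) : (r : Rmax) + ((-r : ℝ) : Rmax) + a = a := by
  rw [← WithBot.coe_add]; simp

theorem mp_cancel2 (r : ℝ) (a : Rmax) : a + ((-r : ℝ) : Rmax) + (r : Rmax) = a := by
  rw [add_assoc, ← WithBot.coe_add]; simp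

/-- For a square max-plus matrix `A` with finite diagonal entries `d`
satisfying `det_ε(A) = a₁₁ + ⋯ + aₙₙ`, the product `L_A U_A` agrees with `A` on the
first row, the first column and the diagonal. -/
theorem maxplus_LU_first_row_col_diag {n : ℕ} (hn : 0 < n)
    (A : Fin n → Fin n → Rmax) (d : Fin n → ℝ)
    (hdiag : ∀ i, A i i = (d i : Rmax))
    (hdet : ∀ σ : Equiv.Perm (Fin n), ∑ i, A i (σ i) ≤ ∑ i, A i i) :
    (∀ j : Fin n, mpMulMat (Lfac A d) (Ufac A) ⟨0, hn⟩ j = A ⟨0, hn⟩ j) ∧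
    (∀ j : Fin n, mpMulMat (Lfac A d) (Ufac A) j ⟨0, hn⟩ = A j ⟨0, hn⟩) ∧
    (∀ i : Fin n, mpMulMat (Lfac A d) (Ufac A) i i = A i i) := by
  refine ⟨fun j => ?_, fun j => ?_, fun i => ?_⟩
  · apply le_antisymm
    · refine Finset.sup_le fun k _ => ?_
      by_cases hk : k = ⟨0, hn⟩
      · subst hk
        simp [Lfac, Ufac, hdiag, mp_cancel, Fin.le_def]
      · have : ¬ k ≤ ⟨0, hn⟩ := by
          intro h; apply hk; ext; simpa [Fin.le_def] using h
        simp [Lfac, this]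
    · refine le_trans ?_ (Finset.le_sup (mem_univ (⟨0, hn⟩ : Fin n)))
      simp [Lfac, Ufac, hdiag, mp_cancel, Fin.le_def]
  · apply le_antisymm
    · refine Finset.sup_le fun k _ => ?_
      by_cases hk : k = ⟨0, hn⟩
      · subst hk
        simp [Lfac, Ufac, hdiag, mp_cancel2, Fin.le_def]
      · have : ¬ k ≤ ⟨0, hn⟩ := by
          intro h; apply hk; ext; simpa [Fin.le_def] using h
        simp [Ufac, this]
    · refine le_trans ?_ (Finset.le_sup (mem_univ (⟨0, hn⟩ : Fin n)))
      simp [Lfac, Ufac, hdiag, mp_cancel2, Fin.le_def]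
  · apply le_antisymm
    · refine Finset.sup_le fun k _ => ?_
      by_cases hk : k = i
      · subst hk
        simp [Lfac, Ufac, hdiag, mp_cancel]
      · by_cases h : k ≤ i
        · have hp := mp_pair A d hdiag hdet i k (Ne.symm hk)
          simp only [Lfac, Ufac, h, if_true, hdiag]
          generalize A i k = a at *
          generalize A k i = b at *
          induction a using WithBot.recBotCoe with
          | bot => simp
          | coe a =>
            induction b using WithBot.recBotCoe with
            | bot => simp
            | coe b =>
              norm_cast at hp ⊢
              linarith
        · simp [Lfac, h]
    · refine le_trans ?_ (Finset.le_sup (mem_univ i))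
      simp [Lfac, Ufac, hdiag, mp_cancel]
end
end

section
/- Let S be an idempotent semifield whose addition is the maximum for its total order, let U be an n×n upper triangular matrix over S whose diagonal entries are all nonzero, and let b ∈ S^n be a regular vector. If U_{jk} ⊗ b_k ≤ b_j ⊗ U_{kk} for all indices 1 ≤ j < k ≤ n (i.e. U_{jk} ⊗ U_{kk}^{-1} ≤ b_j ⊗ b_k^{-1}), then the vector X* with entries x*_j = b_j ⊗ U_{jj}^{-1} is a solution of the system UX = b and every solution X satisfies X ≤ X* entrywise; moreover, if all these inequalities are strict, then X* is the unique solution of UX = b. -/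
open Finset

noncomputable section

/- An idempotent semifield whose addition is the maximum for its total order is modeled by a
`LinearOrderedCommGroupWithZero`: the nonzero elements form a linearly ordered abelian group,
`0` is an absorbing least element, the semifield addition is `a ⊕ b = max a b`, and every
nonzero element is invertible. -/

/-- Supremum (semifield sum) of finitely many elements of an idempotent semifield;
`0` is the least element. -/
noncomputable def gSupOn {S : Type*} [LinearOrderedCommGroupWithZero S] {n : ℕ}
    (s : Finset (Fin n)) (f : Fin n → S) : S :=
  letI : Bot S := ⟨0⟩
  letI : OrderBot S := { bot_le := fun _ => zero_le' }
  s.sup f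

/-- Supremum (semifield sum) over all indices. -/
noncomputable def gSup {S : Type*} [LinearOrderedCommGroupWithZero S] {n : ℕ}
    (f : Fin n → S) : S :=
  gSupOn univ f

/-- Matrix product over an idempotent semifield: `(A ⬝ B) i j = max_k (A i k * B k j)`. -/
noncomputable def gMulMat {S : Type*} [LinearOrderedCommGroupWithZero S] {n : ℕ}
    (A B : Fin n → Fin n → S) : Fin n → Fin n → S :=
  fun i j => gSup fun k => A i k * B k j

/-- Matrix-vector product over an idempotent semifield: `(A ⬝ x) i = max_k (A i k * x k)`. -/
noncomputable def gMulVec {S : Type*} [LinearOrderedCommGroupWithZero S] {n : ℕ}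
    (A : Fin n → Fin n → S) (x : Fin n → S) : Fin n → S :=
  fun i => gSup fun k => A i k * x k

/-- The lower triangular factor `L` of `A`: `L i j = A i j * (A j j)⁻¹` for `j ≤ i`. -/
noncomputable def gLfac {S : Type*} [LinearOrderedCommGroupWithZero S] {n : ℕ}
    (A : Fin n → Fin n → S) : Fin n → Fin n → S :=
  fun i j => if j ≤ i then A i j * (A j j)⁻¹ else 0

/-- The upper triangular factor `U` of `A`: `U i j = A i j` for `i ≤ j`. -/
noncomputable def gUfac {S : Type*} [LinearOrderedCommGroupWithZero S] {n : ℕ}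
    (A : Fin n → Fin n → S) : Fin n → Fin n → S :=
  fun i j => if i ≤ j then A i j else 0

theorem gSup_le_iff_aux {S : Type*} [LinearOrderedCommGroupWithZero S] {n : ℕ}
    (f : Fin n → S) (a : S) : gSup f ≤ a ↔ ∀ k, f k ≤ a := by
  letI : Bot S := ⟨0⟩
  letI : OrderBot S := { bot_le := fun _ => zero_le' }
  have h : (univ.sup f ≤ a) ↔ ∀ k ∈ univ, f k ≤ a := Finset.sup_le_iff
  exact h.trans ⟨fun h k => h k (mem_univ k), fun h k _ => h k⟩

theorem gSup_attained_aux {S : Type*} [LinearOrderedCommGroupWithZero S] {n : ℕ}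
    (f : Fin n → S) (a : S) (ha : a ≠ 0) (h : gSup f = a) : ∃ k, f k = a := by
  by_contra hc
  push Not at hc
  have hle := (gSup_le_iff_aux f a).1 h.le
  letI : Bot S := ⟨0⟩
  letI : OrderBot S := { bot_le := fun _ => zero_le' }
  have h2 : univ.sup f < a :=
    (Finset.sup_lt_iff (zero_lt_iff.2 ha : (0 : S) < a)).2
      fun k _ => lt_of_le_of_ne (hle k) (hc k)
  exact absurd h (ne_of_lt h2)

/-- Over an idempotent semifield, if `U` is upper triangular with nonzero
diagonal, `b` is regular, and `U j k * b k ≤ b j * U k k` for all `j < k`, then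
`X* = (b j * (U j j)⁻¹)` solves `UX = b` and every solution is `≤ X*`; if moreover all
these inequalities are strict, then `X*` is the unique solution. -/
theorem semifield_U_system_solution {S : Type*} [LinearOrderedCommGroupWithZero S]
    {n : ℕ} (U : Fin n → Fin n → S) (b : Fin n → S)
    (hUtri : ∀ i j : Fin n, j < i → U i j = 0)
    (hdiag : ∀ i, U i i ≠ 0)
    (hb : ∀ i, b i ≠ 0)
    (hineq : ∀ j k : Fin n, j < k → U j k * b k ≤ b j * U k k) :
    ((∀ i, gMulVec U (fun j => b j * (U j j)⁻¹) i = b i) ∧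
      ∀ X : Fin n → S, (∀ i, gMulVec U X i = b i) → ∀ j, X j ≤ b j * (U j j)⁻¹) ∧
    ((∀ j k : Fin n, j < k → U j k * b k < b j * U k k) →
      ∀ X : Fin n → S, (∀ i, gMulVec U X i = b i) → X = fun j => b j * (U j j)⁻¹) := by
  have ub : ∀ X : Fin n → S, (∀ i, gMulVec U X i = b i) → ∀ j, X j ≤ b j * (U j j)⁻¹ := by
    intro X hX j
    have h := (gSup_le_iff_aux _ _).1 (hX j).le j
    rw [← div_eq_mul_inv, le_div_iff₀ (zero_lt_iff.2 (hdiag j)), mul_comm]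
    exact h
  refine ⟨⟨fun i => le_antisymm ((gSup_le_iff_aux _ _).2 fun k => ?_) ?_, ub⟩, ?_⟩
  · rcases lt_trichotomy k i with h | h | h
    · simp [hUtri i k h]
    · subst h
      rw [mul_comm, inv_mul_cancel_right₀ (hdiag k)]
    · rw [← mul_assoc, ← div_eq_mul_inv, div_le_iff₀ (zero_lt_iff.2 (hdiag k))]
      exact hineq i k h
  · have h := (gSup_le_iff_aux (fun k => U i k * (b k * (U k k)⁻¹)) _).1 le_rfl i
    rw [mul_comm, inv_mul_cancel_right₀ (hdiag i)] at h
    exact h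
  · intro hs X hX
    funext i
    obtain ⟨k, hk⟩ := gSup_attained_aux _ _ (hb i) (hX i)
    rcases lt_trichotomy k i with h | h | h
    · rw [hUtri i k h, zero_mul] at hk
      exact absurd hk.symm (hb i)
    · subst h
      rw [← hk, mul_comm (U k k), mul_inv_cancel_right₀ (hdiag k)]
    · exfalso
      have h1 : U i k * X k ≤ U i k * (b k * (U k k)⁻¹) := mul_le_mul_right (ub X hX k) _
      have h2 : U i k * (b k * (U k k)⁻¹) < b i := by
        rw [← mul_assoc, ← div_eq_mul_inv, div_lt_iff₀ (zero_lt_iff.2 (hdiag k))]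
        exact hs i k h
      exact absurd hk (ne_of_lt (h1.trans_lt h2))
end
end

section
/- Let S be an idempotent semifield whose addition is the maximum for its total order, and let A be an n×n matrix over S. Then A is invertible in the semiring of n×n matrices over S (i.e. there exists an n×n matrix B over S with AB = BA = I) if and only if every row of A and every column of A contains exactly one nonzero entry. -/
open Finset

noncomputable section

/-- The identity matrix over an idempotent semifield. -/
def gId {S : Type*} [LinearOrderedCommGroupWithZero S] (n : ℕ) : Fin n → Fin n → S :=
  fun i j => if i = j then 1 else 0

theorem gSup_le_iff' {S : Type*} [LinearOrderedCommGroupWithZero S] {n : ℕ}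
    (f : Fin n → S) (c : S) : gSup f ≤ c ↔ ∀ k, f k ≤ c := by
  letI : Bot S := ⟨0⟩
  letI : OrderBot S := { bot_le := fun _ => zero_le' }
  have h : gSup f = univ.sup f := rfl
  rw [h, Finset.sup_le_iff]
  simp

theorem gMul_one_iff {S : Type*} [LinearOrderedCommGroupWithZero S] {n : ℕ}
    (A B : Fin n → Fin n → S) (h : gMulMat A B = gId n) :
    (∀ i, ∃ k, A i k ≠ 0 ∧ B k i ≠ 0) ∧
      ∀ i j k, A i k ≠ 0 → B k j ≠ 0 → i = j := by
  constructor
  · intro i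
    by_contra! hc
    have h1 : gSup (fun k => A i k * B k i) = 1 := by
      have := congrFun (congrFun h i) i
      simpa [gMulMat, gId] using this
    have h2 : gSup (fun k => A i k * B k i) ≤ 0 := by
      rw [gSup_le_iff']
      intro k
      by_cases ha : A i k = 0
      · simp [ha]
      · simp [hc k ha]
    rw [h1] at h2
    exact absurd h2 (not_le.2 zero_lt_one)
  · intro i j k ha hb
    by_contra hij
    have h1 : gSup (fun k => A i k * B k j) = 0 := by
      have := congrFun (congrFun h i) j
      simpa [gMulMat, gId, hij] using this
    have h2 := (gSup_le_iff' _ _).1 h1.le k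
    exact mul_ne_zero ha hb (le_antisymm h2 zero_le')

theorem gMul_eq_id {S : Type*} [LinearOrderedCommGroupWithZero S] {n : ℕ}
    (A B : Fin n → Fin n → S) (h0 : ∀ i j k, i ≠ j → A i k * B k j = 0)
    (h1 : ∀ i k, A i k * B k i ≤ 1) (h2 : ∀ i, ∃ k, A i k * B k i = 1) :
    gMulMat A B = gId n := by
  funext i j
  by_cases hij : i = j
  · subst hij
    obtain ⟨k, hk⟩ := h2 i
    simp only [gMulMat, gId, if_true]
    apply le_antisymm
    · exact (gSup_le_iff' _ _).2 (h1 i)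
    · have := (gSup_le_iff' (fun k => A i k * B k i) _).1 le_rfl k
      rw [← hk]
      exact this
  · simp only [gMulMat, gId, if_neg hij]
    exact le_antisymm ((gSup_le_iff' _ _).2 fun k => (h0 i j k hij).le) zero_le'

/-- Over an idempotent semifield, a square matrix `A` is invertible
(has a two-sided inverse for the semifield matrix product) iff every row and every
column of `A` contains exactly one nonzero entry. -/
theorem semifield_invertible_iff_monomial {S : Type*} [LinearOrderedCommGroupWithZero S]
    {n : ℕ} (A : Fin n → Fin n → S) :
    (∃ B : Fin n → Fin n → S, gMulMat A B = gId n ∧ gMulMat B A = gId n) ↔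
      (∀ i : Fin n, ∃! j : Fin n, A i j ≠ 0) ∧ (∀ j : Fin n, ∃! i : Fin n, A i j ≠ 0) := by
  constructor
  · rintro ⟨B, hAB, hBA⟩
    obtain ⟨e1, u1⟩ := gMul_one_iff A B hAB
    obtain ⟨e2, u2⟩ := gMul_one_iff B A hBA
    have key : ∀ i j, A i j ≠ 0 → B j i ≠ 0 := by
      intro i j h
      obtain ⟨k, hk, _⟩ := e2 j
      have := u1 i k j h hk
      rwa [this]
    constructor
    · intro i
      obtain ⟨k, hk, _⟩ := e1 i
      exact ⟨k, hk, fun j hj => u2 j k i (key i j hj) hk⟩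
    · intro j
      obtain ⟨k, _, hk⟩ := e2 j
      exact ⟨k, hk, fun i hi => u1 i k j hi (key k j hk)⟩
  · rintro ⟨hr, hc⟩
    have hle : ∀ a : S, a * a⁻¹ ≤ 1 := by
      intro a
      by_cases ha : a = 0
      · simp [ha]
      · rw [mul_inv_cancel₀ ha]
    refine ⟨fun i j => (A j i)⁻¹, gMul_eq_id _ _ ?_ ?_ ?_, gMul_eq_id _ _ ?_ ?_ ?_⟩
    · intro i j k hij
      by_contra hne
      exact hij ((hc k).unique (left_ne_zero_of_mul hne)
        (inv_eq_zero.not.1 (right_ne_zero_of_mul hne)))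
    · exact fun i k => hle _
    · intro i
      obtain ⟨k, hk, _⟩ := hr i
      exact ⟨k, mul_inv_cancel₀ hk⟩
    · intro i j k hij
      by_contra hne
      exact hij ((hr k).unique (inv_eq_zero.not.1 (left_ne_zero_of_mul hne))
        (right_ne_zero_of_mul hne))
    · intro i k
      rw [mul_comm]
      exact hle _
    · intro i
      obtain ⟨k, hk, _⟩ := hc i
      exact ⟨k, inv_mul_cancel₀ hk⟩
end
end
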